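/- In Mat_P(ℂ) the identity q·R·F− − F−·R − F0·R + (q−1)^{−1}·(q^{n/2+1}·K1^{−1}·K2 − q^{k/2}·K1 − q^{(n−k)/2}·K2 + I)·R = 0 holds. -/

import Mathlib

open scoped Classical

noncomputable section

variable {F V : Type} [Field F] [AddCommGroup V] [Module F V]

/-- `v` covers `u` in the projective geometry `P`. -/
def Covers (u v : Submodule F V) : Prop :=
  u ≤ v ∧ Module.finrank F ↥v = Module.finrank F ↥u + 1

/-- `v` slash-covers `u` (relative to the fixed subspace `y`). -/
def SlashCovers (y u v : Submodule F V) : Prop :=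
  Covers u v ∧ Module.finrank F ↥(v ⊓ y) = Module.finrank F ↥(u ⊓ y) + 1

/-- `v` backslash-covers `u` (relative to the fixed subspace `y`). -/
def BackslashCovers (y u v : Submodule F V) : Prop :=
  Covers u v ∧ Module.finrank F ↥(v ⊓ y) = Module.finrank F ↥(u ⊓ y)

/-- `q` raised to a real exponent, as a complex number. -/
def qpow (q : ℕ) (e : ℝ) : ℂ := (((q : ℝ) ^ e : ℝ) : ℂ)

/-- The Gaussian bracket `[m] = (q^m - 1)/(q - 1)` as a rational number. -/
def gaussQ (q m : ℕ) : ℚ := ((q : ℚ) ^ m - 1) / ((q : ℚ) - 1)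

/-- The Gaussian bracket `[m] = (q^m - 1)/(q - 1)` as a complex number. -/
def gaussC (q m : ℕ) : ℂ := ((q : ℂ) ^ m - 1) / ((q : ℂ) - 1)

/-- The diagonal matrix `K1`; the `(u,u)` entry is `q^(k/2 - i)` for `u ∈ P_{i,j}`. -/
def matK1 (q k : ℕ) (y : Submodule F V) : Matrix (Submodule F V) (Submodule F V) ℂ :=
  Matrix.diagonal fun u => qpow q ((k : ℝ) / 2 - (Module.finrank F ↥(u ⊓ y) : ℝ))

/-- The diagonal matrix `K2`; the `(u,u)` entry is `q^(j - (n-k)/2)` for `u ∈ P_{i,j}`. -/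
def matK2 (q n k : ℕ) (y : Submodule F V) : Matrix (Submodule F V) (Submodule F V) ℂ :=
  Matrix.diagonal fun u =>
    qpow q (((Module.finrank F ↥u : ℝ) - (Module.finrank F ↥(u ⊓ y) : ℝ))
      - ((n : ℝ) - (k : ℝ)) / 2)

/-- The 0-1 matrix `L1`; the `(u,v)` entry is `1` iff `v` slash-covers `u`. -/
def matL1 (y : Submodule F V) : Matrix (Submodule F V) (Submodule F V) ℂ :=
  Matrix.of fun u v => if SlashCovers y u v then (1 : ℂ) else 0

/-- The 0-1 matrix `L2`; the `(u,v)` entry is `1` iff `v` backslash-covers `u`. -/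
def matL2 (y : Submodule F V) : Matrix (Submodule F V) (Submodule F V) ℂ :=
  Matrix.of fun u v => if BackslashCovers y u v then (1 : ℂ) else 0

/-- `R1 = L1ᵀ`. -/
def matR1 (y : Submodule F V) : Matrix (Submodule F V) (Submodule F V) ℂ := Matrix.transpose (matL1 y)

/-- `R2 = L2ᵀ`. -/
def matR2 (y : Submodule F V) : Matrix (Submodule F V) (Submodule F V) ℂ := Matrix.transpose (matL2 y)

/-- `R = L1 · R2`. -/
def matR [Fintype (Submodule F V)] (y : Submodule F V) :
    Matrix (Submodule F V) (Submodule F V) ℂ := matL1 y * matR2 y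

/-- `L = R1 · L2`. -/
def matL [Fintype (Submodule F V)] (y : Submodule F V) :
    Matrix (Submodule F V) (Submodule F V) ℂ := matR1 y * matL2 y

/-- The 0-1 matrix `F0`. -/
def matF0 (y : Submodule F V) : Matrix (Submodule F V) (Submodule F V) ℂ :=
  Matrix.of fun u v =>
    if SlashCovers y u (u ⊔ v) ∧ SlashCovers y v (u ⊔ v) ∧
        BackslashCovers y (u ⊓ v) u ∧ BackslashCovers y (u ⊓ v) v then (1 : ℂ) else 0

/-- The 0-1 matrix `F+`. -/
def matFp (y : Submodule F V) : Matrix (Submodule F V) (Submodule F V) ℂ :=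
  Matrix.of fun u v =>
    if BackslashCovers y u (u ⊔ v) ∧ BackslashCovers y v (u ⊔ v) then (1 : ℂ) else 0

/-- The 0-1 matrix `F-`. -/
def matFm (y : Submodule F V) : Matrix (Submodule F V) (Submodule F V) ℂ :=
  Matrix.of fun u v =>
    if SlashCovers y (u ⊓ v) u ∧ SlashCovers y (u ⊓ v) v then (1 : ℂ) else 0

/-- The vertex set `X` of the Grassmann graph: `k`-dimensional subspaces of `V`. -/
abbrev GrassVertex (F V : Type) [Field F] [AddCommGroup V] [Module F V] (k : ℕ) :=
  {z : Submodule F V // Module.finrank F ↥z = k}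

/-- The Grassmann graph `J_q(n,k)`: vertices are adjacent iff their intersection
has dimension `k - 1`. -/
def Grass (F V : Type) [Field F] [AddCommGroup V] [Module F V] (k : ℕ) :
    SimpleGraph (GrassVertex F V k) :=
  SimpleGraph.fromRel fun a b => Module.finrank F ↥(a.1 ⊓ b.1) = k - 1

/-- `B_xy = {z ∈ Γ(x) : ∂(z,y) = ∂(x,y) + 1}`. -/
def Bset {k : ℕ} (x y : GrassVertex F V k) : Set (GrassVertex F V k) :=
  {z | (Grass F V k).Adj x z ∧ (Grass F V k).dist z y = (Grass F V k).dist x y + 1}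

/-- `C_xy = {z ∈ Γ(x) : ∂(z,y) = ∂(x,y) - 1}`. -/
def Cset {k : ℕ} (x y : GrassVertex F V k) : Set (GrassVertex F V k) :=
  {z | (Grass F V k).Adj x z ∧ (Grass F V k).dist z y = (Grass F V k).dist x y - 1}

/-- `A_xy = {z ∈ Γ(x) : ∂(z,y) = ∂(x,y)}`. -/
def Aset {k : ℕ} (x y : GrassVertex F V k) : Set (GrassVertex F V k) :=
  {z | (Grass F V k).Adj x z ∧ (Grass F V k).dist z y = (Grass F V k).dist x y}

/-- `A0_xy`. -/
def A0set {k : ℕ} (x y : GrassVertex F V k) : Set (GrassVertex F V k) :=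
  {z | (Grass F V k).Adj x z ∧
    SlashCovers y.1 z.1 (z.1 ⊔ x.1) ∧ SlashCovers y.1 x.1 (z.1 ⊔ x.1) ∧
    BackslashCovers y.1 (z.1 ⊓ x.1) z.1 ∧ BackslashCovers y.1 (z.1 ⊓ x.1) x.1}

/-- `A+_xy`. -/
def Apset {k : ℕ} (x y : GrassVertex F V k) : Set (GrassVertex F V k) :=
  {z | (Grass F V k).Adj x z ∧
    BackslashCovers y.1 z.1 (z.1 ⊔ x.1) ∧ BackslashCovers y.1 x.1 (z.1 ⊔ x.1)}

/-- `A-_xy`. -/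
def Amset {k : ℕ} (x y : GrassVertex F V k) : Set (GrassVertex F V k) :=
  {z | (Grass F V k).Adj x z ∧
    SlashCovers y.1 (z.1 ⊓ x.1) z.1 ∧ SlashCovers y.1 (z.1 ⊓ x.1) x.1}

/-- The edge `wz` has type `0`. -/
def EdgeType0 {k : ℕ} (y w z : GrassVertex F V k) : Prop :=
  SlashCovers y.1 w.1 (w.1 ⊔ z.1) ∧ SlashCovers y.1 z.1 (w.1 ⊔ z.1) ∧
  BackslashCovers y.1 (w.1 ⊓ z.1) w.1 ∧ BackslashCovers y.1 (w.1 ⊓ z.1) z.1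

/-- The edge `wz` has type `+`. -/
def EdgeTypeP {k : ℕ} (y w z : GrassVertex F V k) : Prop :=
  BackslashCovers y.1 w.1 (w.1 ⊔ z.1) ∧ BackslashCovers y.1 z.1 (w.1 ⊔ z.1)

/-- The edge `wz` has type `-`. -/
def EdgeTypeM {k : ℕ} (y w z : GrassVertex F V k) : Prop :=
  SlashCovers y.1 (w.1 ⊓ z.1) w.1 ∧ SlashCovers y.1 (w.1 ⊓ z.1) z.1

theorem not_slashCovers_self (y u : Submodule F V) : ¬ SlashCovers y u u := fun h => by
  have := h.2
  omega

section Dimension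

variable [FiniteDimensional F V]

theorem finrank_sup_inf_inf (y u v : Submodule F V) :
    Module.finrank F ↥(u ⊓ y) + Module.finrank F ↥(v ⊓ y) ≤
      Module.finrank F ↥((u ⊔ v) ⊓ y) + Module.finrank F ↥((u ⊓ v) ⊓ y) := by
  have h1 := Submodule.finrank_sup_add_finrank_inf_eq (u ⊓ y) (v ⊓ y)
  have h2 : Module.finrank F ↥((u ⊓ y) ⊔ (v ⊓ y)) ≤ Module.finrank F ↥((u ⊔ v) ⊓ y) :=
    Submodule.finrank_mono
      (sup_le (inf_le_inf_right _ le_sup_left) (inf_le_inf_right _ le_sup_right))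
  have h3 : (u ⊓ y) ⊓ (v ⊓ y) = (u ⊓ v) ⊓ y := by rw [inf_inf_inf_comm, inf_idem]
  rw [h3] at h1
  omega

theorem finrank_inf_mono (y : Submodule F V) {u v : Submodule F V} (h : u ≤ v) :
    Module.finrank F ↥(u ⊓ y) ≤ Module.finrank F ↥(v ⊓ y) :=
  Submodule.finrank_mono (inf_le_inf_right _ h)

theorem finrank_add_inf_le (y : Submodule F V) {u v : Submodule F V} (h : u ≤ v) :
    Module.finrank F ↥(v ⊓ y) + Module.finrank F ↥u ≤
      Module.finrank F ↥v + Module.finrank F ↥(u ⊓ y) := by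
  have h1 := Submodule.finrank_sup_add_finrank_inf_eq (v ⊓ y) u
  have h2 : Module.finrank F ↥((v ⊓ y) ⊔ u) ≤ Module.finrank F ↥v :=
    Submodule.finrank_mono (sup_le inf_le_left h)
  have h3 : (v ⊓ y) ⊓ u = u ⊓ y := by
    rw [inf_right_comm, inf_eq_right.2 h]
  rw [h3] at h1
  omega

theorem eq_inf_of_covers {u v w : Submodule F V} (hne : u ≠ v) (hu : Covers w u)
    (hv : Covers w v) : w = u ⊓ v := by
  refine Submodule.eq_of_le_of_finrank_le (le_inf hu.1 hv.1) ?_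
  by_contra hlt
  have h1 : u ⊓ v = u := Submodule.eq_of_le_of_finrank_le inf_le_left (by have := hu.2; omega)
  have h2 : u = v :=
    Submodule.eq_of_le_of_finrank_eq (inf_eq_left.1 h1) (by have := hu.2; have := hv.2; omega)
  exact hne h2

theorem eq_sup_of_covers {u v w : Submodule F V} (hne : u ≠ v) (hu : Covers u w)
    (hv : Covers v w) : w = u ⊔ v := by
  symm
  refine Submodule.eq_of_le_of_finrank_le (sup_le hu.1 hv.1) ?_
  by_contra hlt
  have h1 : u = u ⊔ v := Submodule.eq_of_le_of_finrank_le le_sup_left (by have := hu.2; omega)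
  have h2 : v = u := Submodule.eq_of_le_of_finrank_eq (le_sup_right.trans h1.ge)
    (by have := hu.2; have := hv.2; omega)
  exact hne h2.symm

theorem slashCovers_iff_not_inf_le {y u w : Submodule F V} (h : Covers w u) :
    SlashCovers y w u ↔ ¬ u ⊓ y ≤ w := by
  have h1 := finrank_inf_mono y h.1
  have h2 := finrank_add_inf_le y h.1
  have h3 := h.2
  constructor
  · rintro ⟨-, hs⟩ hle
    have := Submodule.finrank_mono (le_inf hle (inf_le_right : u ⊓ y ≤ y))
    omega
  · intro hle
    refine ⟨h, ?_⟩
    by_contra hne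
    have : w ⊓ y = u ⊓ y :=
      Submodule.eq_of_le_of_finrank_eq (inf_le_inf_right _ h.1) (by omega)
    exact hle (this ▸ inf_le_left)

theorem slashCovers_and_le_iff {y u t w : Submodule F V} (hut : u ≤ t) :
    (SlashCovers y u w ∧ w ≤ t) ↔ (Covers u w ∧ w ≤ u ⊔ t ⊓ y) := by
  constructor
  · rintro ⟨⟨hc, hs⟩, hwt⟩
    refine ⟨hc, ?_⟩
    have h1 : u < u ⊔ w ⊓ y := by
      refine lt_of_le_of_ne le_sup_left fun h => ?_
      have := Submodule.finrank_mono
        (le_inf (sup_eq_left.1 h.symm) (inf_le_right : w ⊓ y ≤ y))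
      omega
    have h2 := Submodule.finrank_lt_finrank_of_lt h1
    have h3 : u ⊔ w ⊓ y = w :=
      Submodule.eq_of_le_of_finrank_le (sup_le hc.1 inf_le_left) (by have := hc.2; omega)
    rw [← h3]
    exact sup_le_sup_left (inf_le_inf_right _ hwt) _
  · rintro ⟨hc, hw⟩
    refine ⟨⟨hc, ?_⟩, hw.trans (sup_le hut inf_le_left)⟩
    have h1 := finrank_inf_mono y hc.1
    have h2 := finrank_add_inf_le y hc.1
    have h3 := hc.2
    by_contra hne
    have h4 : u ⊓ y = w ⊓ y :=
      Submodule.eq_of_le_of_finrank_eq (inf_le_inf_right _ hc.1) (by omega)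
    have h5 : w ≤ u := by
      intro x hx
      obtain ⟨a, ha, b, hb, rfl⟩ := Submodule.mem_sup.1 (hw hx)
      have hbw : b ∈ w := (Submodule.add_mem_iff_right _ (hc.1 ha)).1 hx
      have : b ∈ u ⊓ y := h4 ▸ ⟨hbw, hb.2⟩
      exact add_mem ha this.1
    have := Submodule.finrank_mono h5
    omega

theorem slash_backslash_sup_iff_inf (y u v : Submodule F V) :
    (SlashCovers y u (u ⊔ v) ∧ BackslashCovers y v (u ⊔ v)) ↔
      (BackslashCovers y (u ⊓ v) u ∧ SlashCovers y (u ⊓ v) v) := by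
  have h0 := Submodule.finrank_sup_add_finrank_inf_eq u v
  have h1 := finrank_sup_inf_inf y u v
  have h2 := finrank_inf_mono y (inf_le_left : u ⊓ v ≤ u)
  have h3 := finrank_add_inf_le y (le_sup_left : u ≤ u ⊔ v)
  have h4 := finrank_inf_mono y (le_sup_right : v ≤ u ⊔ v)
  simp only [SlashCovers, BackslashCovers, Covers, inf_le_left, inf_le_right, le_sup_left,
    le_sup_right, true_and]
  omega

theorem slash_sup_iff (y u v : Submodule F V) :
    (SlashCovers y u (u ⊔ v) ∧ SlashCovers y v (u ⊔ v)) ↔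
      ((SlashCovers y u (u ⊔ v) ∧ SlashCovers y v (u ⊔ v) ∧
        BackslashCovers y (u ⊓ v) u ∧ BackslashCovers y (u ⊓ v) v) ∨
        (SlashCovers y (u ⊓ v) u ∧ SlashCovers y (u ⊓ v) v)) := by
  have h0 := Submodule.finrank_sup_add_finrank_inf_eq u v
  have h1 := finrank_sup_inf_inf y u v
  have h2 := finrank_inf_mono y (inf_le_left : u ⊓ v ≤ u)
  have h3 := finrank_add_inf_le y (le_sup_left : u ≤ u ⊔ v)
  have h4 := finrank_add_inf_le y (inf_le_left : u ⊓ v ≤ u)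
  simp only [SlashCovers, BackslashCovers, Covers, inf_le_left, inf_le_right, le_sup_left,
    le_sup_right, true_and]
  omega

end Dimension

section Counting

variable [FiniteDimensional F V]

theorem covers_sup_span_singleton {u : Submodule F V} {x : V} (hx : x ∉ u) :
    Covers u (u ⊔ Submodule.span F {x}) := by
  refine ⟨le_sup_left, ?_⟩
  have h := Submodule.finrank_sup_add_finrank_inf_eq u (Submodule.span F {x})
  have hx0 : x ≠ 0 := fun h => hx (h ▸ u.zero_mem)
  have hd : u ⊓ Submodule.span F {x} = ⊥ :=
    disjoint_iff.1 ((Submodule.disjoint_span_singleton' hx0).2 hx)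
  rw [hd, finrank_bot, finrank_span_singleton hx0] at h
  omega

theorem Covers.sup_span_singleton_eq_iff {u w : Submodule F V} (h : Covers u w) {x : V}
    (hx : x ∉ u) : u ⊔ Submodule.span F {x} = w ↔ x ∈ w := by
  constructor
  · rintro rfl
    exact Submodule.mem_sup_right (Submodule.mem_span_singleton_self x)
  · intro hxw
    refine Submodule.eq_of_le_of_finrank_eq
      (sup_le h.1 ((Submodule.span_singleton_le_iff_mem x w).2 hxw)) ?_
    rw [(covers_sup_span_singleton hx).2, h.2]

theorem card_sdiff_of_le [Fintype F] {u t : Submodule F V} (h : u ≤ t) :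
    ((t : Set V) \ u).ncard + Fintype.card F ^ Module.finrank F u =
      Fintype.card F ^ Module.finrank F t := by
  have : Finite V := Module.finite_of_finite F
  have hc (s : Submodule F V) : (s : Set V).ncard = Fintype.card F ^ Module.finrank F s := by
    rw [← Nat.card_coe_set_eq, ← Nat.card_eq_fintype_card]
    exact Module.natCard_eq_pow_finrank
  rw [← hc, ← hc]
  exact Set.ncard_sdiff_add_ncard_of_subset h

/-- The number of covers of `u` below `t`. -/
theorem ncard_covers_le [Fintype F] {u t : Submodule F V} (h : u ≤ t) :
    ({w | Covers u w ∧ w ≤ t}.ncard : ℂ) =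
      gaussC (Fintype.card F) (Module.finrank F t - Module.finrank F u) := by
  have : Finite V := Module.finite_of_finite F
  have : Fintype V := Fintype.ofFinite V
  have : Finite (Submodule F V) := Finite.of_injective _ SetLike.coe_injective
  have : Fintype (Submodule F V) := Fintype.ofFinite _
  set q := Fintype.card F with hq
  have hq1 : 1 < q := Fintype.one_lt_card
  set S : Finset (Submodule F V) := Finset.univ.filter fun w => Covers u w ∧ w ≤ t
  have hS : {w | Covers u w ∧ w ≤ t}.ncard = S.card := by
    rw [← Set.ncard_coe_finset]; simp [S]
  have hmap : ∀ x ∈ ((t : Set V) \ u).toFinset, u ⊔ Submodule.span F {x} ∈ S := by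
    intro x hx
    simp only [Set.mem_toFinset, Set.mem_sdiff, SetLike.mem_coe] at hx
    simp only [S, Finset.mem_filter, Finset.mem_univ, true_and]
    exact ⟨covers_sup_span_singleton hx.2,
      sup_le h ((Submodule.span_singleton_le_iff_mem x t).2 hx.1)⟩
  have hfib := Finset.card_eq_sum_card_fiberwise hmap
  have hconst : ∀ w ∈ S, (((t : Set V) \ u).toFinset.filter
      fun x => u ⊔ Submodule.span F {x} = w).card + q ^ Module.finrank F u =
        q ^ (Module.finrank F u + 1) := by
    intro w hw
    simp only [S, Finset.mem_filter, Finset.mem_univ, true_and] at hw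
    rw [← hw.1.2, ← card_sdiff_of_le hw.1.1, ← hq, ← Set.ncard_coe_finset]
    congr 2
    ext x
    simp only [Finset.coe_filter, Set.mem_toFinset, Set.mem_sdiff, SetLike.mem_coe,
      Set.mem_ofPred_eq]
    constructor
    · rintro ⟨⟨-, hx⟩, he⟩
      exact ⟨(hw.1.sup_span_singleton_eq_iff hx).1 he, hx⟩
    · rintro ⟨hxw, hx⟩
      exact ⟨⟨hw.2 hxw, hx⟩, (hw.1.sup_span_singleton_eq_iff hx).2 hxw⟩
  have htot := card_sdiff_of_le h
  rw [← hq, Set.ncard_eq_toFinset_card', hfib,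
    Finset.sum_congr rfl fun w hw => Nat.eq_sub_of_add_eq (hconst w hw), Finset.sum_const,
    smul_eq_mul] at htot
  have hle : q ^ Module.finrank F u ≤ q ^ (Module.finrank F u + 1) :=
    Nat.pow_le_pow_right (by omega) (by omega)
  obtain ⟨e, he⟩ := Nat.exists_eq_add_of_le (Submodule.finrank_mono h)
  have htotC := congrArg (Nat.cast : ℕ → ℂ) htot
  rw [he] at htotC
  push_cast [Nat.cast_sub hle] at htotC
  have hq0 : (q : ℂ) ≠ 0 := by exact_mod_cast (by omega : q ≠ 0)
  have hq1' : (q : ℂ) - 1 ≠ 0 := sub_ne_zero.2 (by exact_mod_cast (by omega : q ≠ 1))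
  rw [hS, gaussC, he, Nat.add_sub_cancel_left, eq_div_iff hq1']
  apply mul_left_cancel₀ (pow_ne_zero (Module.finrank F u) hq0)
  rw [pow_succ, pow_add] at htotC
  linear_combination htotC

/-- The number of submodules covered by `u` above `s`. -/
theorem ncard_covered_ge [Fintype F] {s u : Submodule F V} (h : s ≤ u) :
    ({w | Covers w u ∧ s ≤ w}.ncard : ℂ) =
      gaussC (Fintype.card F) (Module.finrank F u - Module.finrank F s) := by
  have hd (w : Submodule F V) :
      Module.finrank F w + Module.finrank F w.dualAnnihilator = Module.finrank F V :=
    Subspace.finrank_add_finrank_dualAnnihilator_eq w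
  have hle {a b : Submodule F V} : a.dualAnnihilator ≤ b.dualAnnihilator ↔ b ≤ a :=
    Subspace.dualAnnihilator_le_dualAnnihilator_iff
  have himage : {w | Covers u.dualAnnihilator w ∧ w ≤ s.dualAnnihilator} =
      Submodule.dualAnnihilator '' {w | Covers w u ∧ s ≤ w} := by
    ext w
    constructor
    · intro hw
      obtain ⟨w, rfl⟩ : ∃ w', Submodule.dualAnnihilator w' = w :=
        ⟨_, Subspace.dualCoannihilator_dualAnnihilator_eq⟩
      refine ⟨w, ⟨⟨hle.1 hw.1.1, ?_⟩, hle.1 hw.2⟩, rfl⟩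
      have := hw.1.2
      have := hd w
      have := hd u
      omega
    · rintro ⟨w, hw, rfl⟩
      refine ⟨⟨hle.2 hw.1.1, ?_⟩, hle.2 hw.2⟩
      have := hw.1.2
      have := hd w
      have := hd u
      omega
  have hcount := ncard_covers_le (hle.2 h)
  rw [himage, Set.ncard_image_of_injective _ fun a b hab =>
    le_antisymm (hle.1 hab.ge) (hle.1 hab.le)] at hcount
  rw [hcount]
  congr 1
  have := hd s
  have := hd u
  omega

theorem ncard_slashCovers_le [Fintype F] (y : Submodule F V) {u t : Submodule F V}
    (h : u ≤ t) : ({w | SlashCovers y u w ∧ w ≤ t}.ncard : ℂ) =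
      gaussC (Fintype.card F)
        (Module.finrank F ↥(t ⊓ y) - Module.finrank F ↥(u ⊓ y)) := by
  simp_rw [slashCovers_and_le_iff h]
  rw [ncard_covers_le le_sup_left]
  congr 1
  have h1 := Submodule.finrank_sup_add_finrank_inf_eq u (t ⊓ y)
  rw [← inf_assoc, inf_eq_left.2 h] at h1
  omega

theorem ncard_slashCovers [Fintype F] (y u : Submodule F V) :
    ({w | SlashCovers y u w}.ncard : ℂ) =
      gaussC (Fintype.card F) (Module.finrank F y - Module.finrank F ↥(u ⊓ y)) := by
  have := ncard_slashCovers_le y (le_top : u ≤ ⊤)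
  rw [top_inf_eq] at this
  simpa only [le_top, and_true] using this

theorem ncard_backslashCovers_le [Fintype F] (y : Submodule F V) {u t : Submodule F V}
    (h : u ≤ t) : ({w | BackslashCovers y u w ∧ w ≤ t}.ncard : ℂ) =
      gaussC (Fintype.card F) (Module.finrank F t - Module.finrank F u) -
      gaussC (Fintype.card F)
        (Module.finrank F ↥(t ⊓ y) - Module.finrank F ↥(u ⊓ y)) := by
  have : Finite V := Module.finite_of_finite F
  have : Finite (Submodule F V) := Finite.of_injective _ SetLike.coe_injective
  rw [← ncard_slashCovers_le y h, ← ncard_covers_le h, eq_sub_iff_add_eq]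
  norm_cast
  rw [← Set.ncard_union_eq]
  · congr 1
    ext w
    simp only [Set.mem_union, Set.mem_ofPred_eq]
    constructor
    · rintro (⟨⟨hc, -⟩, hw⟩ | ⟨⟨hc, -⟩, hw⟩) <;> exact ⟨hc, hw⟩
    · rintro ⟨hc, hw⟩
      have h1 := finrank_inf_mono y hc.1
      have h2 := finrank_add_inf_le y hc.1
      have h3 := hc.2
      by_cases hb : Module.finrank F ↥(w ⊓ y) = Module.finrank F ↥(u ⊓ y)
      · exact Or.inl ⟨⟨hc, hb⟩, hw⟩
      · exact Or.inr ⟨⟨hc, by omega⟩, hw⟩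
  · refine Set.disjoint_left.2 ?_
    rintro w ⟨⟨-, h1⟩, -⟩ ⟨⟨-, h2⟩, -⟩
    omega

theorem ncard_slashCovered [Fintype F] (y u : Submodule F V) :
    ({w | SlashCovers y w u}.ncard : ℂ) =
      gaussC (Fintype.card F) (Module.finrank F u) -
      gaussC (Fintype.card F) (Module.finrank F u - Module.finrank F ↥(u ⊓ y)) := by
  have : Finite V := Module.finite_of_finite F
  have : Finite (Submodule F V) := Finite.of_injective _ SetLike.coe_injective
  have htot := ncard_covered_ge (bot_le : ⊥ ≤ u)
  rw [finrank_bot, Nat.sub_zero] at htot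
  rw [← ncard_covered_ge (inf_le_left : u ⊓ y ≤ u), ← htot, eq_sub_iff_add_eq]
  norm_cast
  rw [← Set.ncard_union_eq]
  · congr 1
    ext w
    simp only [Set.mem_union, Set.mem_ofPred_eq, bot_le, and_true]
    constructor
    · rintro (⟨hc, -⟩ | ⟨hc, -⟩) <;> exact hc
    · intro hc
      rw [slashCovers_iff_not_inf_le hc]
      tauto
  · refine Set.disjoint_left.2 fun w h1 h2 => ?_
    exact (slashCovers_iff_not_inf_le h1.1).1 h1 h2.2

end Counting

section Matrices

variable [Fintype (Submodule F V)]

theorem sum_boole_mul_boole {ι : Type*} [Fintype ι] (p r : ι → Prop) :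
    ∑ w, (if p w then (1 : ℂ) else 0) * (if r w then 1 else 0) =
      ({w | p w ∧ r w}.ncard : ℂ) := by
  have h (w : ι) : (if p w then (1 : ℂ) else 0) * (if r w then 1 else 0) =
      if p w ∧ r w then 1 else 0 := by
    by_cases hp : p w <;> by_cases hr : r w <;> simp [hp, hr]
  simp_rw [h]
  rw [Finset.sum_boole, ← Set.ncard_coe_finset]
  simp

theorem ncard_of_forall_eq {ι : Type*} {p : ι → Prop} {a : ι} [Decidable (p a)] (h : ∀ w, p w → w = a) :
    ({w | p w}.ncard : ℂ) = if p a then 1 else 0 := by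
  split_ifs with ha
  · have : {w | p w} = {a} := by
      ext w
      exact ⟨fun hw => h w hw, by rintro rfl; exact ha⟩
    simp [this]
  · have : {w | p w} = ∅ := by
      ext w
      simp only [Set.mem_ofPred_eq, Set.mem_empty_iff_false, iff_false]
      exact fun hw => ha (h w hw ▸ hw)
    simp [this]

theorem matR1_mul_matL1_apply (y u v : Submodule F V) :
    (matR1 y * matL1 y) u v = ({w | SlashCovers y w u ∧ SlashCovers y w v}.ncard : ℂ) := by
  simp only [matR1, matL1, Matrix.mul_apply, Matrix.transpose_apply, Matrix.of_apply]
  exact sum_boole_mul_boole _ _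

theorem matL1_mul_matR1_apply (y u v : Submodule F V) :
    (matL1 y * matR1 y) u v = ({w | SlashCovers y u w ∧ SlashCovers y v w}.ncard : ℂ) := by
  simp only [matR1, matL1, Matrix.mul_apply, Matrix.transpose_apply, Matrix.of_apply]
  exact sum_boole_mul_boole _ _

theorem matR_apply (y u v : Submodule F V) :
    matR y u v = ({w | SlashCovers y u w ∧ BackslashCovers y v w}.ncard : ℂ) := by
  simp only [matR, matR2, matL1, matL2, Matrix.mul_apply, Matrix.transpose_apply,
    Matrix.of_apply]
  exact sum_boole_mul_boole _ _

theorem matR2_mul_matL1_apply (y u v : Submodule F V) :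
    (matR2 y * matL1 y) u v =
      ({w | BackslashCovers y w u ∧ SlashCovers y w v}.ncard : ℂ) := by
  simp only [matR2, matL1, matL2, Matrix.mul_apply, Matrix.transpose_apply, Matrix.of_apply]
  exact sum_boole_mul_boole _ _

theorem matR1_mul_matR2_apply (y u v : Submodule F V) :
    (matR1 y * matR2 y) u v =
      ({w | SlashCovers y w u ∧ BackslashCovers y v w}.ncard : ℂ) := by
  simp only [matR1, matR2, matL1, matL2, Matrix.mul_apply, Matrix.transpose_apply,
    Matrix.of_apply]
  exact sum_boole_mul_boole _ _

theorem matR2_mul_matR1_apply (y u v : Submodule F V) :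
    (matR2 y * matR1 y) u v =
      ({w | BackslashCovers y w u ∧ SlashCovers y v w}.ncard : ℂ) := by
  simp only [matR1, matR2, matL1, matL2, Matrix.mul_apply, Matrix.transpose_apply,
    Matrix.of_apply]
  exact sum_boole_mul_boole _ _

theorem matR_apply_eq_zero_or (y u v : Submodule F V) :
    matR y u v = 0 ∨ (Module.finrank F v = Module.finrank F u ∧
      Module.finrank F ↥(v ⊓ y) = Module.finrank F ↥(u ⊓ y) + 1) := by
  rw [matR_apply]
  rcases Set.eq_empty_or_nonempty {w | SlashCovers y u w ∧ BackslashCovers y v w} with h | h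
  · left
    simp [h]
  · right
    obtain ⟨w, ⟨⟨-, h1⟩, h2⟩, ⟨-, h3⟩, h4⟩ := h
    omega

variable [FiniteDimensional F V]

theorem matL1_mul_matR2_comm (y : Submodule F V) :
    matL1 y * matR2 y = matR2 y * matL1 y := by
  ext u v
  rw [matR2_mul_matL1_apply]
  refine (matR_apply y u v).trans ?_
  have hne : ∀ {a b c : Submodule F V}, SlashCovers y a c → BackslashCovers y b c → a ≠ b := by
    rintro a b c h1 h2 rfl
    have := h1.2
    have := h2.2
    omega
  have hne' : ∀ {a b c : Submodule F V},
      BackslashCovers y c a → SlashCovers y c b → a ≠ b := by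
    rintro a b c h1 h2 rfl
    have := h1.2
    have := h2.2
    omega
  rw [ncard_of_forall_eq fun w hw => eq_sup_of_covers (hne hw.1 hw.2) hw.1.1 hw.2.1,
    ncard_of_forall_eq fun w hw => eq_inf_of_covers (hne' hw.1 hw.2) hw.1.1 hw.2.1]
  exact if_congr (slash_backslash_sup_iff_inf y u v) rfl rfl

theorem matR1_mul_matR2 [Fintype F] (y : Submodule F V) :
    matR1 y * matR2 y = (Fintype.card F : ℂ) • (matR2 y * matR1 y) := by
  ext u v
  rw [Matrix.smul_apply, matR1_mul_matR2_apply, matR2_mul_matR1_apply, smul_eq_mul]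
  have hq1 : (Fintype.card F : ℂ) - 1 ≠ 0 :=
    sub_ne_zero.2 (by exact_mod_cast (Fintype.one_lt_card (α := F)).ne')
  by_cases h : v ≤ u ∧ Module.finrank F u = Module.finrank F v + 2 ∧
      Module.finrank F ↥(u ⊓ y) = Module.finrank F ↥(v ⊓ y) + 1
  · obtain ⟨hvu, hd, hy⟩ := h
    have h1 : {w | SlashCovers y w u ∧ BackslashCovers y v w} =
        {w | BackslashCovers y v w ∧ w ≤ u} := by
      ext w
      simp only [SlashCovers, BackslashCovers, Covers, Set.mem_ofPred_eq]
      constructor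
      · rintro ⟨⟨⟨a, b⟩, c⟩, hb⟩
        exact ⟨hb, a⟩
      · rintro ⟨⟨⟨a, b⟩, c⟩, hb⟩
        exact ⟨⟨⟨hb, by omega⟩, by omega⟩, ⟨a, b⟩, c⟩
    have h2 : {w | BackslashCovers y w u ∧ SlashCovers y v w} =
        {w | SlashCovers y v w ∧ w ≤ u} := by
      ext w
      simp only [SlashCovers, BackslashCovers, Covers, Set.mem_ofPred_eq]
      constructor
      · rintro ⟨⟨⟨a, b⟩, c⟩, hb⟩
        exact ⟨hb, a⟩
      · rintro ⟨⟨⟨a, b⟩, c⟩, hb⟩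
        exact ⟨⟨⟨hb, by omega⟩, by omega⟩, ⟨a, b⟩, c⟩
    rw [h1, h2, ncard_backslashCovers_le y hvu, ncard_slashCovers_le y hvu, hd, hy,
      Nat.add_sub_cancel_left, Nat.add_sub_cancel_left]
    simp only [gaussC]
    field_simp
    ring
  · have h1 : {w | SlashCovers y w u ∧ BackslashCovers y v w} = ∅ := by
      ext w
      simp only [SlashCovers, BackslashCovers, Covers, Set.mem_ofPred_eq,
        Set.mem_empty_iff_false, iff_false]
      rintro ⟨⟨⟨a, b⟩, c⟩, ⟨a', b'⟩, c'⟩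
      exact h ⟨a'.trans a, by omega, by omega⟩
    have h2 : {w | BackslashCovers y w u ∧ SlashCovers y v w} = ∅ := by
      ext w
      simp only [SlashCovers, BackslashCovers, Covers, Set.mem_ofPred_eq,
        Set.mem_empty_iff_false, iff_false]
      rintro ⟨⟨⟨a, b⟩, c⟩, ⟨a', b'⟩, c'⟩
      exact h ⟨a'.trans a, by omega, by omega⟩
    simp [h1, h2]

theorem matFm_eq [Fintype F] (y : Submodule F V) :
    matFm y = matR1 y * matL1 y - Matrix.diagonal fun u : Submodule F V =>
      gaussC (Fintype.card F) (Module.finrank F u) -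
      gaussC (Fintype.card F) (Module.finrank F u - Module.finrank F ↥(u ⊓ y)) := by
  ext u v
  rw [Matrix.sub_apply, matR1_mul_matL1_apply]
  by_cases huv : u = v
  · subst huv
    simp [ncard_slashCovered, matFm, not_slashCovers_self]
  · rw [ncard_of_forall_eq fun w hw => eq_inf_of_covers huv hw.1.1 hw.2.1,
      Matrix.diagonal_apply_ne _ huv, sub_zero]
    rfl

theorem matF0_add_matFm_eq [Fintype F] (y : Submodule F V) :
    matF0 y + matFm y = matL1 y * matR1 y - Matrix.diagonal fun u : Submodule F V =>
      gaussC (Fintype.card F) (Module.finrank F y - Module.finrank F ↥(u ⊓ y)) := by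
  ext u v
  rw [Matrix.sub_apply, matL1_mul_matR1_apply, Matrix.add_apply]
  by_cases huv : u = v
  · subst huv
    simp [ncard_slashCovers, matF0, matFm, not_slashCovers_self]
  · rw [ncard_of_forall_eq fun w hw => eq_sup_of_covers huv hw.1.1 hw.2.1,
      Matrix.diagonal_apply_ne _ huv, sub_zero]
    rw [if_congr (slash_sup_iff y u v) rfl rfl]
    simp only [matF0, matFm, Matrix.of_apply]
    by_cases h1 : SlashCovers y (u ⊓ v) u ∧ SlashCovers y (u ⊓ v) v
    · have h2 : ¬ BackslashCovers y (u ⊓ v) u := fun h => by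
        have := h.2
        have := h1.1.2
        omega
      simp [h1, h2]
    · simp [h1]

end Matrices

theorem qpow_mul {q : ℕ} (hq : 0 < q) (a b : ℝ) : qpow q a * qpow q b = qpow q (a + b) := by
  simp only [qpow]
  rw [Real.rpow_add (by exact_mod_cast hq)]
  push_cast
  rfl

theorem qpow_natCast (q m : ℕ) : qpow q m = (q : ℂ) ^ m := by
  simp [qpow]

theorem matK1_inv [Fintype (Submodule F V)] {q : ℕ} (hq : 0 < q) (k : ℕ)
    (y : Submodule F V) : (matK1 q k y)⁻¹ = Matrix.diagonal fun u : Submodule F V =>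
      qpow q ((Module.finrank F ↥(u ⊓ y) : ℝ) - (k : ℝ) / 2) := by
  refine Matrix.inv_eq_right_inv ?_
  rw [matK1, Matrix.diagonal_mul_diagonal, ← Matrix.diagonal_one]
  congr 1
  ext u
  rw [qpow_mul hq]
  simp [qpow]

theorem weight_eq_diagonal [FiniteDimensional F V] [Fintype (Submodule F V)] {q : ℕ}
    (hq : 0 < q) (n k : ℕ) (y : Submodule F V) (hy : Module.finrank F y = k) :
    qpow q ((n : ℝ) / 2 + 1) • ((matK1 q k y)⁻¹ * matK2 q n k y)
        - qpow q ((k : ℝ) / 2) • matK1 q k y - qpow q (((n : ℝ) - (k : ℝ)) / 2) • matK2 q n k y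
        + (1 : Matrix (Submodule F V) (Submodule F V) ℂ) =
      Matrix.diagonal fun u : Submodule F V => (q : ℂ) ^ (Module.finrank F u + 1) -
        (q : ℂ) ^ (k - Module.finrank F ↥(u ⊓ y)) -
        (q : ℂ) ^ (Module.finrank F u - Module.finrank F ↥(u ⊓ y)) + 1 := by
  rw [matK1_inv hq, matK1, matK2, Matrix.diagonal_mul_diagonal, ← Matrix.diagonal_smul,
    ← Matrix.diagonal_smul, ← Matrix.diagonal_smul, Matrix.diagonal_sub, Matrix.diagonal_sub,
    ← Matrix.diagonal_one, Matrix.diagonal_add]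
  congr 1
  ext u
  have h1 : Module.finrank F ↥(u ⊓ y) ≤ Module.finrank F u := Submodule.finrank_mono inf_le_left
  have h2 : Module.finrank F ↥(u ⊓ y) ≤ k := hy ▸ Submodule.finrank_mono inf_le_right
  simp only [Pi.smul_apply, smul_eq_mul, qpow_mul hq]
  rw [← qpow_natCast, ← qpow_natCast, ← qpow_natCast]
  push_cast [Nat.cast_sub h1, Nat.cast_sub h2]
  ring_nf

theorem statement2
    (q n k : ℕ) (hq : IsPrimePow q) (hkn : k < n) (hk : 1 ≤ k)
    (F V : Type) [Field F] [Fintype F] (hcard : Fintype.card F = q)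
    [AddCommGroup V] [Module F V] [FiniteDimensional F V]
    (hdim : Module.finrank F V = n)
    [Fintype (Submodule F V)]
    (y : Submodule F V) (hy : Module.finrank F ↥y = k) :
    (q : ℂ) • (matR y * matFm y) - matFm y * matR y - matF0 y * matR y +
      (((q : ℂ) - 1)⁻¹ • (qpow q ((n : ℝ) / 2 + 1) • ((matK1 q k y)⁻¹ * matK2 q n k y)
        - qpow q ((k : ℝ) / 2) • matK1 q k y - qpow q (((n : ℝ) - (k : ℝ)) / 2) • matK2 q n k y
        + (1 : Matrix (Submodule F V) (Submodule F V) ℂ))) * matR y = 0 := by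
  subst hcard
  have hq1 : (Fintype.card F : ℂ) - 1 ≠ 0 :=
    sub_ne_zero.2 (by exact_mod_cast (Fintype.one_lt_card (α := F)).ne')
  rw [weight_eq_diagonal Fintype.card_pos n k y hy]
  have hcancel : (Fintype.card F : ℂ) • (matR y * (matR1 y * matL1 y)) =
      matL1 y * matR1 y * matR y := by
    calc (Fintype.card F : ℂ) • (matR y * (matR1 y * matL1 y))
        = matL1 y * ((Fintype.card F : ℂ) • (matR2 y * matR1 y)) * matL1 y := by
          simp only [matR, Matrix.mul_assoc, Matrix.mul_smul, Matrix.smul_mul]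
      _ = matL1 y * matR1 y * (matR2 y * matL1 y) := by
          rw [← matR1_mul_matR2]
          simp only [Matrix.mul_assoc]
      _ = matL1 y * matR1 y * matR y := by
          rw [← matL1_mul_matR2_comm, matR]
  have hFm := matFm_eq y
  have hF0 := matF0_add_matFm_eq y
  rw [sub_sub, ← Matrix.add_mul, add_comm (matFm y), hF0, hFm, Matrix.mul_sub, smul_sub,
    Matrix.sub_mul, hcancel, sub_sub_sub_cancel_left, ← Matrix.diagonal_smul]
  ext u v
  simp only [Matrix.add_apply, Matrix.sub_apply, Matrix.smul_apply, Matrix.diagonal_mul,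
    Matrix.mul_diagonal, Matrix.zero_apply, smul_eq_mul, Pi.smul_apply]
  rcases matR_apply_eq_zero_or y u v with h | ⟨h1, h2⟩
  · simp [h]
  · have h3 : Module.finrank F ↥(v ⊓ y) ≤ Module.finrank F v :=
      Submodule.finrank_mono inf_le_left
    rw [h1, h2] at h3
    obtain ⟨e, he⟩ := Nat.exists_eq_add_of_le h3
    have h4 : Module.finrank F u - (Module.finrank F ↥(u ⊓ y) + 1) = e := by omega
    have h5 : Module.finrank F u - Module.finrank F ↥(u ⊓ y) = e + 1 := by omega
    rw [h1, h2, h4, h5, hy]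
    simp only [gaussC]
    field_simp
    ring
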